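/- For every irrational ρ ∈ (0,1), the convex set Λ_ρ has infinitely many extreme points, and the set of accumulation points of the set of extreme points of Λ_ρ is exactly the two-point set {(0, ρ), (ρ, 0)}. -/

import Mathlib

open Filter Topology

noncomputable def alphaSeq (ρ : ℝ) (n : ℕ) : ℝ := (⌈(n : ℝ) * ρ⌉ : ℝ) - (n : ℝ) * ρ

noncomputable def vecRho (ρ : ℝ) (m n : ℕ) : ℝ × ℝ :=
  ((⌈(m : ℝ) * ρ⌉ : ℝ) / ((m : ℝ) + (n : ℝ) + 1),
   (⌈(n : ℝ) * ρ⌉ : ℝ) / ((m : ℝ) + (n : ℝ) + 1))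

noncomputable def LambdaSet (ρ : ℝ) : Set (ℝ × ℝ) :=
  closure (convexHull ℝ
    ({((0 : ℝ), (0 : ℝ))} ∪
      {p : ℝ × ℝ | ∃ m n : ℕ, alphaSeq ρ m < ρ ∧ alphaSeq ρ n < ρ ∧ p = vecRho ρ m n}))

def halfPlane (p q r : ℝ) : Set (ℝ × ℝ) := {z | p * z.1 + q * z.2 ≤ r}

theorem convex_halfPlane (p q r : ℝ) : Convex ℝ (halfPlane p q r) := by
  intro x hx y hy a b ha hb hab
  simp only [halfPlane, Set.mem_ofPred_eq, Prod.fst_add, Prod.snd_add, Prod.smul_fst, Prod.smul_snd,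
    smul_eq_mul] at *
  calc p * (a * x.1 + b * y.1) + q * (a * x.2 + b * y.2)
      = a * (p * x.1 + q * x.2) + b * (p * y.1 + q * y.2) := by ring
    _ ≤ a * r + b * r := by gcongr
    _ = r := by rw [← add_mul, hab, one_mul]

theorem isClosed_halfPlane (p q r : ℝ) : IsClosed (halfPlane p q r) :=
  isClosed_le (by fun_prop) continuous_const

/-- The convex hull of a finite set together with a compact convex set is compact. -/
theorem isCompact_convexHull_union {F C : Set (ℝ × ℝ)} (hF : F.Finite) (hC : IsCompact C)
    (hconv : Convex ℝ C) : IsCompact (convexHull ℝ (F ∪ C)) := by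
  rcases F.eq_empty_or_nonempty with rfl | hFne
  · simpa [hconv.convexHull_eq] using hC
  rcases C.eq_empty_or_nonempty with rfl | hCne
  · simpa using hF.isCompact_convexHull ℝ
  have himage : convexHull ℝ (F ∪ C) = (fun w : ℝ × (ℝ × ℝ) × (ℝ × ℝ) =>
      (1 - w.1) • w.2.1 + w.1 • w.2.2) '' (Set.Icc 0 1 ×ˢ convexHull ℝ F ×ˢ C) := by
    rw [convexHull_union hFne hCne, hconv.convexHull_eq]
    ext z
    simp only [mem_convexJoin, segment_eq_image, Set.mem_image, Set.mem_prod]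
    constructor
    · rintro ⟨a, ha, b, hb, t, ht, rfl⟩
      exact ⟨(t, a, b), ⟨ht, ha, hb⟩, rfl⟩
    · rintro ⟨⟨t, a, b⟩, ⟨ht, ha, hb⟩, rfl⟩
      exact ⟨a, ha, b, hb, t, ht, rfl⟩
  rw [himage]
  exact (isCompact_Icc.prod ((hF.isCompact_convexHull ℝ).prod hC)).image (by fun_prop)

theorem ceil_eq_add_alphaSeq (ρ : ℝ) (n : ℕ) : (⌈(n : ℝ) * ρ⌉ : ℝ) = n * ρ + alphaSeq ρ n := by
  rw [alphaSeq]; ring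

theorem alphaSeq_nonneg (ρ : ℝ) (n : ℕ) : 0 ≤ alphaSeq ρ n :=
  sub_nonneg.2 (Int.le_ceil _)

theorem alphaSeq_zero (ρ : ℝ) : alphaSeq ρ 0 = 0 := by simp [alphaSeq]

theorem exists_alphaSeq_mem_Ioo {ρ a b : ℝ} (hirr : Irrational ρ) (ha : 0 ≤ a) (hb : b ≤ 1)
    (hab : a < b) : ∃ n : ℕ, a < alphaSeq ρ n ∧ alphaSeq ρ n < b := by
  have hdense : DenseRange (· • ((-ρ : ℝ) : AddCircle (1 : ℝ)) : ℕ → AddCircle (1 : ℝ)) := by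
    have : Fact ((0 : ℝ) < 1) := ⟨one_pos⟩
    rw [← denseRange_zsmul_iff_nsmul, AddCircle.denseRange_zsmul_coe_iff]
    simpa using hirr.neg
  have hopen : IsOpen ((fun x : ℝ => (x : AddCircle (1 : ℝ))) '' Set.Ioo a b) :=
    QuotientAddGroup.isOpenMap_coe _ isOpen_Ioo
  obtain ⟨n, x, ⟨hax, hxb⟩, hx⟩ := hdense.exists_mem_open hopen
    ((Set.nonempty_Ioo.2 hab).image _)
  have hx' : ((x - n * (-ρ) : ℝ) : AddCircle (1 : ℝ)) = 0 := by
    have hx : (x : AddCircle (1 : ℝ)) = n • ((-ρ : ℝ) : AddCircle (1 : ℝ)) := hx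
    rw [AddCircle.coe_sub, sub_eq_zero, hx, ← nsmul_eq_mul, AddCircle.coe_nsmul]
  obtain ⟨k, hk⟩ := (AddCircle.coe_eq_zero_iff (1 : ℝ)).1 hx'
  have hk' : (k : ℝ) = x + n * ρ := by
    simp only [zsmul_eq_mul, mul_one] at hk
    linarith
  have hceil : ⌈(n : ℝ) * ρ⌉ = k := by
    rw [Int.ceil_eq_iff]
    constructor <;> linarith
  have halpha : alphaSeq ρ n = x := by
    rw [alphaSeq, hceil, hk']; ring
  exact ⟨n, by rwa [halpha], by rwa [halpha]⟩

/-- The generators of `LambdaSet ρ`; the origin is one of them, with `m = n = 0`. -/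
def rhoPoints (ρ : ℝ) : Set (ℝ × ℝ) :=
  {p | ∃ m n : ℕ, alphaSeq ρ m < ρ ∧ alphaSeq ρ n < ρ ∧ p = vecRho ρ m n}

theorem zero_mem_rhoPoints {ρ : ℝ} (h0 : 0 < ρ) : ((0 : ℝ), (0 : ℝ)) ∈ rhoPoints ρ :=
  ⟨0, 0, by rwa [alphaSeq_zero], by rwa [alphaSeq_zero], by simp [vecRho]⟩

theorem LambdaSet_eq {ρ : ℝ} (h0 : 0 < ρ) :
    LambdaSet ρ = closure (convexHull ℝ (rhoPoints ρ)) := by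
  have h : {((0 : ℝ), (0 : ℝ))} ∪ rhoPoints ρ = rhoPoints ρ :=
    Set.union_eq_self_of_subset_left (Set.singleton_subset_iff.2 (zero_mem_rhoPoints h0))
  rw [← h]
  rfl

theorem rhoPoints_subset_LambdaSet {ρ : ℝ} (h0 : 0 < ρ) : rhoPoints ρ ⊆ LambdaSet ρ := by
  rw [LambdaSet_eq h0]
  exact (subset_convexHull ℝ _).trans subset_closure

theorem isClosed_LambdaSet (ρ : ℝ) : IsClosed (LambdaSet ρ) := isClosed_closure

theorem convex_LambdaSet (ρ : ℝ) : Convex ℝ (LambdaSet ρ) := (convex_convexHull ℝ _).closure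

theorem LambdaSet_subset {ρ : ℝ} (h0 : 0 < ρ) {T : Set (ℝ × ℝ)} (hT : Convex ℝ T)
    (hT' : IsClosed T) (h : rhoPoints ρ ⊆ T) : LambdaSet ρ ⊆ T := by
  rw [LambdaSet_eq h0]
  exact closure_minimal (convexHull_min h hT) hT'

theorem vecRho_add_sub {ρ : ℝ} (m n : ℕ) : (vecRho ρ m n).1 + (vecRho ρ m n).2 - ρ =
    (alphaSeq ρ m + alphaSeq ρ n - ρ) / ((m : ℝ) + n + 1) := by
  have : (m : ℝ) + n + 1 ≠ 0 := by positivity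
  simp only [vecRho, ceil_eq_add_alphaSeq]
  field_simp
  ring

theorem vecRho_mem_Icc {ρ : ℝ} (h0 : 0 < ρ) (h1 : ρ < 1) (m n : ℕ) :
    vecRho ρ m n ∈ Set.Icc (0 : ℝ × ℝ) 1 := by
  have hnonneg (k : ℕ) : (0 : ℝ) ≤ ⌈(k : ℝ) * ρ⌉ :=
    le_trans (by positivity) (Int.le_ceil ((k : ℝ) * ρ))
  have hle (k : ℕ) : (⌈(k : ℝ) * ρ⌉ : ℝ) ≤ k := by
    have : ⌈(k : ℝ) * ρ⌉ ≤ (k : ℤ) := by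
      rw [Int.ceil_le]
      push_cast
      exact mul_le_of_le_one_right (by positivity) h1.le
    exact_mod_cast this
  have hm := hle m
  have hn := hle n
  have hm' : (0 : ℝ) ≤ m := m.cast_nonneg
  have hn' : (0 : ℝ) ≤ n := n.cast_nonneg
  refine ⟨⟨div_nonneg (hnonneg m) (by positivity), div_nonneg (hnonneg n) (by positivity)⟩,
    ⟨?_, ?_⟩⟩
  · exact div_le_one_of_le₀ (by linarith) (by positivity)
  · exact div_le_one_of_le₀ (by linarith) (by positivity)

theorem LambdaSet_subset_Icc {ρ : ℝ} (h0 : 0 < ρ) (h1 : ρ < 1) :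
    LambdaSet ρ ⊆ Set.Icc (0 : ℝ × ℝ) 1 := by
  refine LambdaSet_subset h0 (convex_Icc _ _) isClosed_Icc ?_
  rintro _ ⟨m, n, -, -, rfl⟩
  exact vecRho_mem_Icc h0 h1 m n

theorem isCompact_LambdaSet {ρ : ℝ} (h0 : 0 < ρ) (h1 : ρ < 1) : IsCompact (LambdaSet ρ) :=
  isCompact_Icc.of_isClosed_subset (isClosed_LambdaSet ρ) (LambdaSet_subset_Icc h0 h1)

theorem finite_rhoPoints_far {ρ η : ℝ} (h1 : ρ < 1) (hη : 0 < η) :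
    {z ∈ rhoPoints ρ | η < |z.1 + z.2 - ρ|}.Finite := by
  obtain ⟨N, hN⟩ := exists_nat_gt (1 / η)
  refine (((Set.finite_Iio N).prod (Set.finite_Iio N)).image
    (fun w : ℕ × ℕ => vecRho ρ w.1 w.2)).subset ?_
  rintro _ ⟨⟨m, n, hm, hn, rfl⟩, hz⟩
  have hpos : (0 : ℝ) < (m : ℝ) + n + 1 := by positivity
  rw [vecRho_add_sub, abs_div, abs_of_pos hpos, lt_div_iff₀ hpos] at hz
  have hbound : |alphaSeq ρ m + alphaSeq ρ n - ρ| ≤ 1 := by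
    have := alphaSeq_nonneg ρ m
    have := alphaSeq_nonneg ρ n
    rw [abs_le]
    constructor <;> linarith
  have hlt : (m : ℝ) + n + 1 < N := by
    refine lt_trans ?_ hN
    rw [lt_div_iff₀ hη]
    linarith
  have hlt' : m + n + 1 < N := by exact_mod_cast hlt
  exact ⟨(m, n), ⟨by simp; omega, by simp; omega⟩, rfl⟩

theorem extremePoints_LambdaSet_subset {ρ : ℝ} (h0 : 0 < ρ) (h1 : ρ < 1) :
    Set.extremePoints ℝ (LambdaSet ρ) ⊆ rhoPoints ρ ∪ {z | z.1 + z.2 = ρ} := by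
  intro e he
  by_cases hline : e.1 + e.2 = ρ
  · exact Or.inr hline
  left
  set η := |e.1 + e.2 - ρ| / 2 with hη_def
  have hη : 0 < η := half_pos (abs_pos.2 (sub_ne_zero.2 hline))
  set F := {z ∈ rhoPoints ρ | η < |z.1 + z.2 - ρ|} with hF_def
  set C := LambdaSet ρ ∩ (halfPlane 1 1 (ρ + η) ∩ halfPlane (-1) (-1) (η - ρ)) with hC_def
  have hFfin : F.Finite := finite_rhoPoints_far h1 hη
  have hCclosed : IsClosed (halfPlane 1 1 (ρ + η) ∩ halfPlane (-1) (-1) (η - ρ)) :=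
    (isClosed_halfPlane _ _ _).inter (isClosed_halfPlane _ _ _)
  have hCcomp : IsCompact C := (isCompact_LambdaSet h0 h1).inter_right hCclosed
  have hCconv : Convex ℝ C :=
    (convex_LambdaSet ρ).inter ((convex_halfPlane _ _ _).inter (convex_halfPlane _ _ _))
  have hmemC (z : ℝ × ℝ) : z ∈ C ↔ z ∈ LambdaSet ρ ∧ |z.1 + z.2 - ρ| ≤ η := by
    simp only [hC_def, halfPlane, Set.mem_inter_iff, Set.mem_ofPred_eq, abs_le]
    constructor
    · rintro ⟨hz, h2, h3⟩
      exact ⟨hz, by linarith, by linarith⟩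
    · rintro ⟨hz, h2, h3⟩
      exact ⟨hz, by linarith, by linarith⟩
  have hLambda : LambdaSet ρ = convexHull ℝ (F ∪ C) := by
    refine Set.Subset.antisymm ?_ ?_
    · refine LambdaSet_subset h0 (convex_convexHull ℝ _)
        (isCompact_convexHull_union hFfin hCcomp hCconv).isClosed ?_
      intro z hz
      refine subset_convexHull ℝ _ ?_
      rcases lt_or_ge η |z.1 + z.2 - ρ| with h | h
      · exact Or.inl ⟨hz, h⟩
      · exact Or.inr ((hmemC z).2 ⟨rhoPoints_subset_LambdaSet h0 hz, h⟩)
    · refine convexHull_min (Set.union_subset ?_ ?_) (convex_LambdaSet ρ)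
      · exact fun z hz => rhoPoints_subset_LambdaSet h0 hz.1
      · exact fun z hz => hz.1
  rw [hLambda] at he
  rcases extremePoints_convexHull_subset he with h | h
  · exact h.1
  · have := ((hmemC e).1 h).2
    linarith

/-- Accumulation points of the extreme points lie on the line `x + y = ρ`. -/
theorem AccPt.add_eq_of_extremePoints_LambdaSet {ρ : ℝ} (h0 : 0 < ρ) (h1 : ρ < 1) {z : ℝ × ℝ}
    (hz : AccPt z (𝓟 (Set.extremePoints ℝ (LambdaSet ρ)))) : z.1 + z.2 = ρ := by
  by_contra hline
  set η := |z.1 + z.2 - ρ| / 2 with hη_def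
  have hη : 0 < η := half_pos (abs_pos.2 (sub_ne_zero.2 hline))
  have hU : {w : ℝ × ℝ | η < |w.1 + w.2 - ρ|} ∈ 𝓝 z :=
    (isOpen_lt continuous_const (by fun_prop)).mem_nhds
      (show η < |z.1 + z.2 - ρ| by linarith)
  have hacc := hz.nhds_inter hU
  refine Set.Infinite.of_accPt hacc ((finite_rhoPoints_far h1 hη).subset ?_)
  rintro w ⟨hw, hwe⟩
  rcases extremePoints_LambdaSet_subset h0 h1 hwe with h | h
  · exact ⟨h, hw⟩
  · have hw' : η < |w.1 + w.2 - ρ| := hw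
    rw [show w.1 + w.2 = ρ from h, sub_self, abs_zero] at hw'
    linarith

theorem swap_mem_LambdaSet {ρ : ℝ} (h0 : 0 < ρ) {z : ℝ × ℝ} (hz : z ∈ LambdaSet ρ) :
    z.swap ∈ LambdaSet ρ := by
  have hconv : Convex ℝ (Prod.swap ⁻¹' LambdaSet ρ) :=
    (convex_LambdaSet ρ).linear_preimage (LinearEquiv.prodComm ℝ ℝ ℝ).toLinearMap
  refine LambdaSet_subset h0 hconv ((isClosed_LambdaSet ρ).preimage continuous_swap) ?_ hz
  rintro _ ⟨m, n, hm, hn, rfl⟩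
  exact rhoPoints_subset_LambdaSet h0 ⟨n, m, hn, hm, by simp [vecRho, add_comm (m : ℝ)]⟩

theorem AccPt.swap_extremePoints_LambdaSet {ρ : ℝ} (h0 : 0 < ρ) {z : ℝ × ℝ}
    (hz : AccPt z (𝓟 (Set.extremePoints ℝ (LambdaSet ρ)))) :
    AccPt z.swap (𝓟 (Set.extremePoints ℝ (LambdaSet ρ))) := by
  have hswap : Prod.swap '' LambdaSet ρ = LambdaSet ρ := by
    refine Set.Subset.antisymm ?_ fun w hw => ⟨w.swap, swap_mem_LambdaSet h0 hw, w.swap_swap⟩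
    rintro _ ⟨w, hw, rfl⟩
    exact swap_mem_LambdaSet h0 hw
  have himage : Prod.swap '' Set.extremePoints ℝ (LambdaSet ρ) =
      Set.extremePoints ℝ (LambdaSet ρ) := by
    have h := image_extremePoints (𝕜 := ℝ) (LinearEquiv.prodComm ℝ ℝ ℝ) (LambdaSet ρ)
    have hcoe : ⇑(LinearEquiv.prodComm ℝ ℝ ℝ) = Prod.swap := rfl
    rwa [hcoe, hswap] at h
  have h := hz.map continuous_swap.continuousAt Prod.swap_injective
  rwa [map_principal, himage] at h

theorem zero_left_mem_LambdaSet {ρ : ℝ} (hirr : Irrational ρ) (h0 : 0 < ρ) (h1 : ρ < 1) :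
    ((0 : ℝ), ρ) ∈ LambdaSet ρ := by
  rw [← (isClosed_LambdaSet ρ).closure_eq, Metric.mem_closure_iff]
  intro ε hε
  obtain ⟨n, hn, hn'⟩ := exists_alphaSeq_mem_Ioo (a := max 0 (ρ - ε)) (b := ρ) hirr
    (le_max_left _ _) h1.le (max_lt h0 (by linarith))
  refine ⟨vecRho ρ 0 n, rhoPoints_subset_LambdaSet h0 ⟨0, n, by rwa [alphaSeq_zero], hn', rfl⟩, ?_⟩
  have hfst : (vecRho ρ 0 n).1 = 0 := by simp [vecRho]
  have hsnd := vecRho_add_sub (ρ := ρ) 0 n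
  rw [hfst, alphaSeq_zero, zero_add, zero_add, Nat.cast_zero, zero_add] at hsnd
  have hε' := (le_max_right 0 (ρ - ε)).trans_lt hn
  rw [Prod.dist_eq, hfst, dist_self, dist_comm, Real.dist_eq, hsnd, abs_div,
    abs_of_neg (by linarith), abs_of_pos (by positivity)]
  refine max_lt hε ((div_le_self (by linarith) ?_).trans_lt (by linarith))
  have : (0 : ℝ) ≤ n := n.cast_nonneg
  linarith

theorem mem_interior_LambdaSet {ρ : ℝ} (hirr : Irrational ρ) (h0 : 0 < ρ) (h1 : ρ < 1)
    {z : ℝ × ℝ} (hx : 0 < z.1) (hy : 0 < z.2) (hz : z.1 + z.2 = ρ) :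
    z ∈ interior (LambdaSet ρ) := by
  obtain ⟨m, hm, hm'⟩ := exists_alphaSeq_mem_Ioo (a := ρ / 2) (b := ρ) hirr (by linarith) h1.le
    (by linarith)
  set a := (vecRho ρ m m).1 with ha_def
  have hpt : (a, a) ∈ LambdaSet ρ := rhoPoints_subset_LambdaSet h0 ⟨m, m, hm', hm', rfl⟩
  have ha : 0 < 2 * a - ρ := by
    have h := vecRho_add_sub (ρ := ρ) m m
    have hpos : 0 < (alphaSeq ρ m + alphaSeq ρ m - ρ) / ((m : ℝ) + m + 1) :=
      div_pos (by linarith) (by positivity)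
    have h2 : (vecRho ρ m m).2 = a := rfl
    rw [h2] at h
    linarith
  have hleft := zero_left_mem_LambdaSet hirr h0 h1
  have hright : (ρ, (0 : ℝ)) ∈ LambdaSet ρ := swap_mem_LambdaSet h0 hleft
  have hzero := rhoPoints_subset_LambdaSet h0 (zero_mem_rhoPoints h0)
  have hcomb {b₁ b₂ b₃ : ℝ} (hb₁ : 0 ≤ b₁) (hb₂ : 0 ≤ b₂) (hb₃ : 0 ≤ b₃) (hb : b₁ + b₂ + b₃ ≤ 1) :
      b₁ • ((a, a) : ℝ × ℝ) + b₂ • (ρ, (0 : ℝ)) + b₃ • ((0 : ℝ), ρ) ∈ LambdaSet ρ := by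
    have h := (convex_LambdaSet ρ).sum_mem (t := Finset.univ)
      (w := ![b₁, b₂, b₃, 1 - (b₁ + b₂ + b₃)])
      (z := ![(a, a), (ρ, 0), (0, ρ), (0, 0)]) ?_ ?_ ?_
    · simpa [Fin.sum_univ_four] using h
    · intro i _
      fin_cases i <;> simp <;> linarith
    · simp [Fin.sum_univ_four]
    · intro i _
      fin_cases i <;> simpa
  set U : Set (ℝ × ℝ) := {w | 0 < w.1 ∧ 0 < w.2 ∧ (w.1 + w.2 - ρ) * a < w.1 * (2 * a - ρ) ∧
    (w.1 + w.2 - ρ) * a < w.2 * (2 * a - ρ)} with hU_def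
  have hU : IsOpen U := by
    simp only [hU_def, Set.ofPred_and]
    refine IsOpen.inter ?_ (IsOpen.inter ?_ (IsOpen.inter ?_ ?_)) <;>
      exact isOpen_lt (by fun_prop) (by fun_prop)
  refine mem_interior.2 ⟨U, ?_, hU, hx, hy, ?_, ?_⟩
  · rintro ⟨x, y⟩ ⟨hx, hy, hx', hy'⟩
    simp only at hx hy hx' hy'
    rcases le_total (x + y) ρ with h | h
    · have := hcomb (b₁ := 0) (b₂ := x / ρ) (b₃ := y / ρ) le_rfl (by positivity) (by positivity)
        (by rw [zero_add, ← add_div]; exact div_le_one_of_le₀ h h0.le)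
      convert this using 1
      ext <;> simp [h0.ne']
    · set t := (x + y - ρ) / (2 * a - ρ) with ht
      have ht0 : 0 ≤ t := div_nonneg (by linarith) ha.le
      have htm : t * (2 * a - ρ) = x + y - ρ := div_mul_cancel₀ _ ha.ne'
      have htx : t * a ≤ x := by
        rw [ht, div_mul_eq_mul_div, div_le_iff₀ ha]
        exact hx'.le
      have hty : t * a ≤ y := by
        rw [ht, div_mul_eq_mul_div, div_le_iff₀ ha]
        exact hy'.le
      have := hcomb (b₁ := t) (b₂ := (x - t * a) / ρ) (b₃ := (y - t * a) / ρ) ht0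
        (div_nonneg (by linarith) h0.le) (div_nonneg (by linarith) h0.le) (by
          rw [add_assoc, ← add_div, ← le_sub_iff_add_le', div_le_iff₀ h0]
          linarith)
      convert this using 1
      ext <;> simp [h0.ne']
  · rw [hz, sub_self, zero_mul]; exact mul_pos hx ha
  · rw [hz, sub_self, zero_mul]; exact mul_pos hy ha

theorem AccPt.eq_of_extremePoints_LambdaSet {ρ : ℝ} (hirr : Irrational ρ) (h0 : 0 < ρ) (h1 : ρ < 1)
    {z : ℝ × ℝ} (hz : AccPt z (𝓟 (Set.extremePoints ℝ (LambdaSet ρ)))) :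
    z = ((0 : ℝ), ρ) ∨ z = (ρ, (0 : ℝ)) := by
  have hline := hz.add_eq_of_extremePoints_LambdaSet h0 h1
  have hmem : z ∈ LambdaSet ρ := by
    rw [← (isClosed_LambdaSet ρ).closure_eq]
    exact closure_mono extremePoints_subset (mem_closure_iff_clusterPt.2 hz.clusterPt)
  obtain ⟨⟨hx, hy⟩, -⟩ := LambdaSet_subset_Icc h0 h1 hmem
  simp only [Prod.fst_zero, Prod.snd_zero] at hx hy
  rcases hx.eq_or_lt with hx | hx
  · exact Or.inl (Prod.ext hx.symm (by simp only; linarith))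
  rcases hy.eq_or_lt with hy | hy
  · exact Or.inr (Prod.ext (by simp only; linarith) hy.symm)
  have hint := mem_interior_LambdaSet hirr h0 h1 hx hy hline
  obtain ⟨w, ⟨hw, hwe⟩, -⟩ := accPt_iff_nhds.1 hz _ (isOpen_interior.mem_nhds hint)
  exact (Set.disjoint_left.1 (disjoint_interior_extremePoints _) hw hwe).elim

theorem infinite_extremePoints_LambdaSet {ρ : ℝ} (hirr : Irrational ρ) (h0 : 0 < ρ) (h1 : ρ < 1) :
    (Set.extremePoints ℝ (LambdaSet ρ)).Infinite := by
  intro hfin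
  set R : Set ℝ := {r | ∃ m : ℕ, m ≠ 0 ∧ alphaSeq ρ m < ρ ∧ r = alphaSeq ρ m / ⌈(m : ℝ) * ρ⌉}
    with hR_def
  set c := sSup R with hc_def
  have hceil_nonneg (m : ℕ) : (0 : ℝ) ≤ ⌈(m : ℝ) * ρ⌉ :=
    le_trans (by positivity) (Int.le_ceil ((m : ℝ) * ρ))
  have hceil_pos {m : ℕ} (hm : m ≠ 0) : (0 : ℝ) < ⌈(m : ℝ) * ρ⌉ :=
    lt_of_lt_of_le (by positivity) (Int.le_ceil ((m : ℝ) * ρ))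
  have hRbdd : BddAbove R := by
    refine ⟨1, ?_⟩
    rintro _ ⟨m, -, -, rfl⟩
    refine div_le_one_of_le₀ ?_ (hceil_nonneg m)
    rw [ceil_eq_add_alphaSeq]
    exact le_add_of_nonneg_left (by positivity)
  obtain ⟨k, hk, hk'⟩ := exists_alphaSeq_mem_Ioo hirr le_rfl h1.le h0
  have hk0 : k ≠ 0 := by
    rintro rfl
    exact hk.ne' (alphaSeq_zero ρ)
  have hkR : alphaSeq ρ k / ⌈(k : ℝ) * ρ⌉ ∈ R := ⟨k, hk0, hk', rfl⟩
  have hc : 0 < c := (div_pos hk (hceil_pos hk0)).trans_le (le_csSup hRbdd hkR)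
  have halpha {m : ℕ} (hm : alphaSeq ρ m < ρ) : alphaSeq ρ m ≤ c * ⌈(m : ℝ) * ρ⌉ := by
    rcases eq_or_ne m 0 with rfl | hm0
    · simp [alphaSeq_zero]
    · rw [← div_le_iff₀ (hceil_pos hm0)]
      exact le_csSup hRbdd ⟨m, hm0, hm, rfl⟩
  have hstrict {z : ℝ × ℝ} (hz : z ∈ rhoPoints ρ) : z.1 + z.2 - ρ < c * z.1 := by
    obtain ⟨m, n, hm, hn, rfl⟩ := hz
    rw [vecRho_add_sub, vecRho, ← mul_div_assoc]
    have := halpha hm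
    gcongr
    linarith
  have hevent : ∀ᶠ δ in 𝓝[>] (0 : ℝ), ∀ e ∈ Set.extremePoints ℝ (LambdaSet ρ),
      e.1 + e.2 - ρ ≤ (c - δ) * e.1 := by
    refine (eventually_all_finite hfin).2 fun e he => ?_
    rcases extremePoints_LambdaSet_subset h0 h1 he with h | h
    · have hcont : Tendsto (fun δ : ℝ => (c - δ) * e.1) (𝓝[>] 0) (𝓝 ((c - 0) * e.1)) :=
        (Continuous.tendsto (by fun_prop) 0).mono_left nhdsWithin_le_nhds
      rw [sub_zero] at hcont
      exact (hcont.eventually (lt_mem_nhds (hstrict h))).mono fun _ hδ => hδ.le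
    · filter_upwards [nhdsWithin_le_nhds (gt_mem_nhds hc)] with δ hδ
      rw [show e.1 + e.2 = ρ from h, sub_self]
      exact mul_nonneg (by linarith)
        (LambdaSet_subset_Icc h0 h1 (extremePoints_subset he)).1.1
  obtain ⟨δ, hδ, hδ0⟩ := (hevent.and self_mem_nhdsWithin).exists
  have hδ0 : 0 < δ := hδ0
  have hsub : LambdaSet ρ ⊆ halfPlane (1 - c + δ) 1 ρ := by
    rw [← closure_convexHull_extremePoints (isCompact_LambdaSet h0 h1) (convex_LambdaSet ρ)]
    refine closure_minimal (convexHull_min (fun e he => ?_) (convex_halfPlane _ _ _))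
      (isClosed_halfPlane _ _ _)
    have := hδ e he
    simp only [halfPlane, Set.mem_ofPred_eq]
    linarith
  obtain ⟨_, ⟨m, hm0, hm, rfl⟩, hmc⟩ := exists_lt_of_lt_csSup ⟨_, hkR⟩ (sub_lt_self c hδ0)
  rw [lt_div_iff₀ (hceil_pos hm0)] at hmc
  obtain ⟨n, hn, hn'⟩ := exists_alphaSeq_mem_Ioo
    (a := max 0 (ρ - (alphaSeq ρ m - (c - δ) * ⌈(m : ℝ) * ρ⌉))) (b := ρ) hirr
    (le_max_left _ _) h1.le (max_lt h0 (by linarith))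
  have hn'' := (le_max_right _ _).trans_lt hn
  have hle : (1 - c + δ) * (vecRho ρ m n).1 + 1 * (vecRho ρ m n).2 ≤ ρ :=
    hsub (rhoPoints_subset_LambdaSet h0 ⟨m, n, hm, hn', rfl⟩)
  have hlt : (c - δ) * (vecRho ρ m n).1 < (vecRho ρ m n).1 + (vecRho ρ m n).2 - ρ := by
    rw [vecRho_add_sub, vecRho, ← mul_div_assoc]
    gcongr
    linarith
  linarith

theorem stmt1 (ρ : ℝ) (hirr : Irrational ρ) (h0 : 0 < ρ) (h1 : ρ < 1) :
    (Set.extremePoints ℝ (LambdaSet ρ)).Infinite ∧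
    {x : ℝ × ℝ | AccPt x (𝓟 (Set.extremePoints ℝ (LambdaSet ρ)))} =
      {((0 : ℝ), ρ), (ρ, (0 : ℝ))} := by
  have hinf := infinite_extremePoints_LambdaSet hirr h0 h1
  refine ⟨hinf, Set.Subset.antisymm (fun z hz => hz.eq_of_extremePoints_LambdaSet hirr h0 h1) ?_⟩
  obtain ⟨z, -, hz⟩ := hinf.exists_accPt_of_subset_isCompact (isCompact_LambdaSet h0 h1)
    extremePoints_subset
  have hz' := hz.swap_extremePoints_LambdaSet h0
  rcases hz.eq_of_extremePoints_LambdaSet hirr h0 h1 with rfl | rfl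
  · rintro _ (rfl | rfl)
    exacts [hz, hz']
  · rintro _ (rfl | rfl)
    exacts [hz', hz]
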